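/- Let e0, e1 be the standard basis of ℂ², set P0 = |e0⟩⟨e0|, P1 = |e1⟩⟨e1|, and let τ_z = (1/2)(|e0⊗e1⟩⟨e0⊗e1| + |e1⊗e0⟩⟨e1⊗e0|) as a 4×4 matrix indexed by (Fin 2)×(Fin 2). For α ∈ ℝ, define ε_α = (1/√2)(e0⊗e1 + e^{iα} e1⊗e0) ∈ ℂ⁴. Then a 4×4 complex matrix Ω is positive semidefinite with trace 1 and satisfies (P0⊗I₂) Ω (P0⊗I₂) + (P1⊗I₂) Ω (P1⊗I₂) = τ_z if and only if Ω lies in the convex hull (over ℝ) of the set { |ε_α⟩⟨ε_α| : α ∈ ℝ }. -/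

import Mathlib

open Matrix Kronecker
open scoped ComplexOrder

noncomputable section

/-- The outer product `|u⟩⟨v|` of two vectors. -/
def outer {ι : Type*} (u v : ι → ℂ) : Matrix ι ι ℂ :=
  Matrix.of fun i j => u i * star (v j)

/-- The tensor (Kronecker) product of two qubit vectors. -/
def tens (u v : Fin 2 → ℂ) : Fin 2 × Fin 2 → ℂ := fun p => u p.1 * v p.2

def e0 : Fin 2 → ℂ := ![1, 0]
def e1 : Fin 2 → ℂ := ![0, 1]

/-- `ε_α = (1/√2)(e0⊗e1 + e^{iα} e1⊗e0)`. -/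
def eps (α : ℝ) : Fin 2 × Fin 2 → ℂ :=
  ((Real.sqrt 2 : ℂ))⁻¹ • (tens e0 e1 + Complex.exp ((α : ℂ) * Complex.I) • tens e1 e0)

/-- The matrix supported on the span of `e0 ⊗ e1` and `e1 ⊗ e0`, with diagonal entries `1/2` and
coherence `z / 2`. -/
def coherenceMatrix (z : ℂ) : Matrix (Fin 2 × Fin 2) (Fin 2 × Fin 2) ℂ :=
  ((1 : ℂ) / 2) • (outer (tens e0 e1) (tens e0 e1) + outer (tens e1 e0) (tens e1 e0)
    + z • outer (tens e1 e0) (tens e0 e1) + star z • outer (tens e0 e1) (tens e1 e0))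

lemma outer_eps (α : ℝ) :
    outer (eps α) (eps α) = coherenceMatrix (Complex.exp (α * Complex.I)) := by
  have hs : (Real.sqrt 2 : ℂ)⁻¹ * (Real.sqrt 2 : ℂ)⁻¹ = 1 / 2 := by
    rw [← mul_inv, ← Complex.ofReal_mul, Real.mul_self_sqrt (by norm_num)]
    norm_num
  have he : Complex.exp (α * Complex.I) * (starRingEnd ℂ) (Complex.exp (α * Complex.I)) = 1 := by
    rw [Complex.mul_conj, Complex.normSq_eq_norm_sq, Complex.norm_exp_ofReal_mul_I]
    norm_num
  ext ⟨i, j⟩ ⟨k, l⟩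
  fin_cases i <;> fin_cases j <;> fin_cases k <;> fin_cases l <;>
    simp [outer, eps, coherenceMatrix, tens, e0, e1] <;> grind

lemma posSemidef_outer {ι : Type*} [Fintype ι] (u : ι → ℂ) : (outer u u).PosSemidef :=
  posSemidef_vecMulVec_self_star u

lemma Matrix.PosSemidef.normSq_apply_le {ι : Type*} [Fintype ι] [DecidableEq ι]
    {M : Matrix ι ι ℂ} (hM : M.PosSemidef) (i j : ι) :
    (Complex.normSq (M i j) : ℂ) ≤ M i i * M j j := by
  have h := (hM.submatrix ![i, j]).det_nonneg
  rw [det_fin_two] at h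
  have hji : M j i = star (M i j) := (hM.1.apply j i).symm
  simp only [submatrix_apply, cons_val_zero, cons_val_one, hji] at h
  rw [← Complex.mul_conj]
  exact sub_nonneg.mp h

lemma coherenceMatrix_mem_convexHull {z : ℂ} (hz : ‖z‖ ≤ 1) :
    coherenceMatrix z ∈ convexHull ℝ {M | ∃ α : ℝ, M = outer (eps α) (eps α)} := by
  have h₁ : coherenceMatrix (Complex.exp (z.arg * Complex.I)) ∈
      convexHull ℝ {M | ∃ α : ℝ, M = outer (eps α) (eps α)} :=
    subset_convexHull ℝ _ ⟨z.arg, (outer_eps _).symm⟩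
  have h₂ : coherenceMatrix (-Complex.exp (z.arg * Complex.I)) ∈
      convexHull ℝ {M | ∃ α : ℝ, M = outer (eps α) (eps α)} := by
    refine subset_convexHull ℝ _ ⟨z.arg + Real.pi, ?_⟩
    rw [outer_eps]
    congr 1
    push_cast
    rw [add_mul, Complex.exp_add, Complex.exp_pi_mul_I, mul_neg_one]
  have h := convex_convexHull ℝ _ h₁ h₂ (a := (1 + ‖z‖) / 2) (b := (1 - ‖z‖) / 2)
    (by positivity) (by linarith) (by ring)
  convert h using 1
  have hz' : z = ‖z‖ * Complex.exp (z.arg * Complex.I) := (Complex.norm_mul_exp_arg_mul_I z).symm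
  generalize Complex.exp (z.arg * Complex.I) = w at hz'
  generalize ‖z‖ = r at hz'
  subst hz'
  ext i j
  simp only [coherenceMatrix, Matrix.add_apply, Matrix.smul_apply, smul_eq_mul, Complex.real_smul,
    star_mul', star_neg, Complex.star_def, Complex.conj_ofReal]
  push_cast
  ring

/-- The dephasing of the first qubit keeps the diagonal blocks and erases the others. -/
lemma pinching_apply (Ω : Matrix (Fin 2 × Fin 2) (Fin 2 × Fin 2) ℂ) (p q : Fin 2 × Fin 2) :
    ((outer e0 e0 ⊗ₖ (1 : Matrix (Fin 2) (Fin 2) ℂ)) * Ω *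
          (outer e0 e0 ⊗ₖ (1 : Matrix (Fin 2) (Fin 2) ℂ)) +
        (outer e1 e1 ⊗ₖ (1 : Matrix (Fin 2) (Fin 2) ℂ)) * Ω *
          (outer e1 e1 ⊗ₖ (1 : Matrix (Fin 2) (Fin 2) ℂ))) p q
      = if p.1 = q.1 then Ω p q else 0 := by
  obtain ⟨i, j⟩ := p
  obtain ⟨k, l⟩ := q
  fin_cases i <;> fin_cases j <;> fin_cases k <;> fin_cases l <;>
    simp [Matrix.mul_apply, Fintype.sum_prod_type, outer, e0, e1, Matrix.one_apply]

lemma eq_coherenceMatrix {Ω : Matrix (Fin 2 × Fin 2) (Fin 2 × Fin 2) ℂ} (hΩ : Ω.PosSemidef)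
    (h : ∀ p q, (if p.1 = q.1 then Ω p q else 0) =
      (((1 : ℂ) / 2) • (outer (tens e0 e1) (tens e0 e1) + outer (tens e1 e0) (tens e1 e0))) p q) :
    ∃ z : ℂ, ‖z‖ ≤ 1 ∧ Ω = coherenceMatrix z := by
  have d₀ : Ω (0, 0) (0, 0) = 0 := by simpa [outer, tens, e0, e1] using h (0, 0) (0, 0)
  have d₁ : Ω (0, 1) (0, 1) = 1 / 2 := by simpa [outer, tens, e0, e1] using h (0, 1) (0, 1)
  have d₂ : Ω (1, 0) (1, 0) = 1 / 2 := by simpa [outer, tens, e0, e1] using h (1, 0) (1, 0)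
  have d₃ : Ω (1, 1) (1, 1) = 0 := by simpa [outer, tens, e0, e1] using h (1, 1) (1, 1)
  have row {p q : Fin 2 × Fin 2} (hp : Ω p p = 0) : Ω p q = 0 := by
    have := hΩ.normSq_apply_le p q
    rw [hp, zero_mul] at this
    exact Complex.normSq_eq_zero.mp (le_antisymm (by exact_mod_cast this) (Complex.normSq_nonneg _))
  have col {p q : Fin 2 × Fin 2} (hq : Ω q q = 0) : Ω p q = 0 := by
    rw [← hΩ.1.apply, row hq, star_zero]
  refine ⟨2 * Ω (1, 0) (0, 1), ?_, ?_⟩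
  · have := hΩ.normSq_apply_le (1, 0) (0, 1)
    rw [d₁, d₂, Complex.normSq_eq_norm_sq] at this
    have h' : ‖Ω (1, 0) (0, 1)‖ ^ 2 ≤ 1 / 2 * (1 / 2) := by
      rw [← Complex.real_le_real]
      push_cast at this ⊢
      exact this
    rw [norm_mul, Complex.norm_two]
    nlinarith [norm_nonneg (Ω (1, 0) (0, 1))]
  · have hstar : Ω (0, 1) (1, 0) = (starRingEnd ℂ) (Ω (1, 0) (0, 1)) := (hΩ.1.apply _ _).symm
    ext ⟨i, j⟩ ⟨k, l⟩
    fin_cases i <;> fin_cases j <;> fin_cases k <;> fin_cases l <;>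
      simp [coherenceMatrix, outer, tens, e0, e1, row d₀, row d₃, col d₀, col d₃, d₁, d₂, hstar]

theorem scenario_one_solution_set
    (Ω : Matrix (Fin 2 × Fin 2) (Fin 2 × Fin 2) ℂ) :
    (Ω.PosSemidef ∧ Ω.trace = 1 ∧
      (outer e0 e0 ⊗ₖ (1 : Matrix (Fin 2) (Fin 2) ℂ)) * Ω *
          (outer e0 e0 ⊗ₖ (1 : Matrix (Fin 2) (Fin 2) ℂ)) +
        (outer e1 e1 ⊗ₖ (1 : Matrix (Fin 2) (Fin 2) ℂ)) * Ω *
          (outer e1 e1 ⊗ₖ (1 : Matrix (Fin 2) (Fin 2) ℂ))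
        = ((1 : ℂ)/2) • (outer (tens e0 e1) (tens e0 e1) + outer (tens e1 e0) (tens e1 e0)))
    ↔ Ω ∈ convexHull ℝ {M | ∃ α : ℝ, M = outer (eps α) (eps α)} := by
  rw [← Matrix.ext_iff]
  simp only [pinching_apply]
  constructor
  · rintro ⟨hΩ, -, h⟩
    obtain ⟨z, hz, rfl⟩ := eq_coherenceMatrix hΩ h
    exact coherenceMatrix_mem_convexHull hz
  · intro h
    refine convexHull_min (t := {A | A.PosSemidef ∧ A.trace = 1 ∧
      ∀ p q : Fin 2 × Fin 2, (if p.1 = q.1 then A p q else 0) =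
        (((1 : ℂ) / 2) • (outer (tens e0 e1) (tens e0 e1) + outer (tens e1 e0) (tens e1 e0))) p q})
      ?_ ?_ h
    · rintro _ ⟨α, rfl⟩
      refine ⟨posSemidef_outer _, ?_, ?_⟩
      · rw [outer_eps]
        simp [Matrix.trace, Fintype.sum_prod_type, coherenceMatrix, outer, tens, e0, e1]
        norm_num
      · rintro ⟨i, j⟩ ⟨k, l⟩
        rw [outer_eps]
        fin_cases i <;> fin_cases j <;> fin_cases k <;> fin_cases l <;>
          simp [coherenceMatrix, outer, tens, e0, e1]
    · rintro A ⟨hA, tA, pA⟩ B ⟨hB, tB, pB⟩ a b ha hb hab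
      refine ⟨(hA.smul ha).add (hB.smul hb), ?_, fun p q => ?_⟩
      · rw [Matrix.trace_add, Matrix.trace_smul, Matrix.trace_smul, tA, tB, ← add_smul, hab,
          one_smul]
      · rw [← Convex.combo_self hab ((((1 : ℂ) / 2) • (outer (tens e0 e1) (tens e0 e1) +
          outer (tens e1 e0) (tens e1 e0))) p q)]
        nth_rw 1 [← pA p q]
        rw [← pB p q]
        split_ifs <;> simp
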